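/- Let π be a Fano permutation of ZZ_2^3. Then for all nonzero x ≠ y in ZZ_2^3, ⟨x, π(y)⟩ + ⟨y, π(x)⟩ = 1 (addition mod 2). -/

import Mathlib

/-- The group `ZZ_2^3`. -/
abbrev V3 := Fin 3 → ZMod 2

/-- A permutation of `ZZ_2^3` is antilinear if it fixes `0` and no three nonzero elements
summing to zero are mapped to three elements summing to zero. -/
def Antilinear (π : Equiv.Perm V3) : Prop :=
  π 0 = 0 ∧ ∀ x y z : V3, x ≠ 0 → y ≠ 0 → z ≠ 0 → x + y + z ≠ 0 ∨ π x + π y + π z ≠ 0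

/-- The standard inner product (dot product mod 2) on `ZZ_2^3`. -/
def dotp (x y : V3) : ZMod 2 := ∑ j, x j * y j

/-- The signature of a permutation of `ZZ_2^3`. -/
def sig (π : Equiv.Perm V3) (x : V3) : V3 :=
  ∑ y ∈ Finset.univ.filter (fun y => dotp x y = 0), π y

/-- A Fano permutation is an antilinear permutation whose signature is the identity. -/
def Fano (π : Equiv.Perm V3) : Prop := Antilinear π ∧ ∀ x, sig π x = x

/-- Identification of `{0,…,7}` with `ZZ_2^3` via binary representation. -/
def ofN (i : Fin 8) : V3 := fun j => if Nat.testBit i.val j.val then 1 else 0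

/-- Identification of `ZZ_2^3` with `{0,…,7}` via binary representation. -/
def toN (x : V3) : Fin 8 :=
  ⟨(x 0).val + 2 * (x 1).val + 4 * (x 2).val, by
    have h0 := ZMod.val_lt (x 0); have h1 := ZMod.val_lt (x 1)
    have h2 := ZMod.val_lt (x 2); omega⟩

/-- The permutation of `ZZ_2^3` described, via the binary identification, by a
table of images of `0,…,7`. -/
noncomputable def permOf (v : Fin 8 → Fin 8) (h : Function.Bijective fun x : V3 => ofN (v (toN x))) :
    Equiv.Perm V3 :=
  Equiv.ofBijective _ h

/-- The quadratic map determined by the images `a`, `b`, `c` of the unit vectors. -/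
def quadF (a b c y : V3) : V3 :=
  ![y 0 * a 0 + y 1 * b 0 + y 2 * c 0 + y 1 * y 2,
    y 0 * a 1 + y 1 * b 1 + y 2 * c 1 + y 0 * y 2,
    y 0 * a 2 + y 1 * b 2 + y 2 * c 2 + y 0 * y 1]

set_option maxRecDepth 100000 in
theorem quadF_key : ∀ a b c : V3,
    (∀ x y : V3, quadF a b c x = quadF a b c y → x = y) →
    ∀ x y : V3, x = 0 ∨ y = 0 ∨ x = y ∨
      dotp x (quadF a b c y) + dotp y (quadF a b c x) = 1 := by
  decide +kernel

theorem vec_eta (x : V3) : x = ![x 0, x 1, x 2] := by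
  ext i; fin_cases i <;> rfl

theorem sig_filter :
    (Finset.univ.filter (fun y : V3 => dotp ![0,0,1] y = 0) = {0, ![1,0,0], ![0,1,0], ![1,1,0]}) ∧
    (Finset.univ.filter (fun y : V3 => dotp ![0,1,0] y = 0) = {0, ![1,0,0], ![0,0,1], ![1,0,1]}) ∧
    (Finset.univ.filter (fun y : V3 => dotp ![1,0,0] y = 0) = {0, ![0,1,0], ![0,0,1], ![0,1,1]}) ∧
    (Finset.univ.filter (fun y : V3 => dotp ![0,1,1] y = 0) = {0, ![1,0,0], ![0,1,1], ![1,1,1]}) := by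
  decide +kernel

theorem sum_four (f : V3 → V3) (p q r : V3) (h0 : f 0 = 0)
    (h : (0 ≠ p ∧ 0 ≠ q ∧ 0 ≠ r) ∧ p ≠ q ∧ p ≠ r ∧ q ≠ r) :
    ∑ y ∈ ({0, p, q, r} : Finset V3), f y = f p + f q + f r := by
  obtain ⟨⟨h1, h2, h3⟩, h4, h5, h6⟩ := h
  rw [Finset.sum_insert (by simp [h1, h2, h3]), Finset.sum_insert (by simp [h4, h5]),
    Finset.sum_insert (by simp [h6]), Finset.sum_singleton, h0]
  abel

theorem solve_last (p q r s : V3) (h : p + q + r = s) : r = p + q + s := by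
  have key : ∀ a b c : ZMod 2, c = a + b + (a + b + c) := by decide
  subst h
  ext i
  exact key _ _ _

theorem fano_eq (π : Equiv.Perm V3) (hπ : Fano π) (y : V3) :
    π y = quadF (π ![1,0,0]) (π ![0,1,0]) (π ![0,0,1]) y := by
  obtain ⟨⟨h0, -⟩, hs⟩ := hπ
  obtain ⟨f1, f2, f3, f4⟩ := sig_filter
  have s1 := hs ![0,0,1]
  have s2 := hs ![0,1,0]
  have s3 := hs ![1,0,0]
  have s4 := hs ![0,1,1]
  unfold sig at s1 s2 s3 s4
  rw [f1, sum_four π _ _ _ h0 (by decide)] at s1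
  rw [f2, sum_four π _ _ _ h0 (by decide)] at s2
  rw [f3, sum_four π _ _ _ h0 (by decide)] at s3
  rw [f4, sum_four π _ _ _ h0 (by decide)] at s4
  replace s1 := solve_last _ _ _ _ s1
  replace s2 := solve_last _ _ _ _ s2
  replace s3 := solve_last _ _ _ _ s3
  replace s4 := solve_last _ _ _ _ s4
  rw [s3] at s4
  have z : (![0,0,0] : V3) = 0 := by decide
  have two : ∀ t : ZMod 2, t = 0 ∨ t = 1 := by decide
  rw [vec_eta y]
  generalize y 0 = y0
  generalize y 1 = y1
  generalize y 2 = y2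
  rcases two y0 with rfl | rfl <;> rcases two y1 with rfl | rfl <;>
    rcases two y2 with rfl | rfl <;>
    (try simp only [z, h0, s1, s2, s3, s4]) <;> ext i <;> fin_cases i <;> simp [quadF] <;> ring_nf <;> rfl

/-- If `π` is a Fano permutation of `ZZ_2^3` and `x ≠ y` are nonzero, then
`⟨x, π(y)⟩ + ⟨y, π(x)⟩ = 1`. -/
theorem stmt13 (π : Equiv.Perm V3) (hπ : Fano π) (x y : V3)
    (hx : x ≠ 0) (hy : y ≠ 0) (hxy : x ≠ y) :
    dotp x (π y) + dotp y (π x) = 1 := by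
  have e := fano_eq π hπ
  generalize π ![1,0,0] = a at e
  generalize π ![0,1,0] = b at e
  generalize π ![0,0,1] = c at e
  have k := quadF_key a b c
  simp only [← e] at k
  rcases k (fun x y h => π.injective h) x y with h | h | h | h
  · exact absurd h hx
  · exact absurd h hy
  · exact absurd h hxy
  · exact h
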